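/- arXiv:2212.05887 — 2 statements merged into one kernel-verified Lean document; each statement's English description precedes it below -/
import Mathlib

section
/- Let $m\geq 4$ be an even integer, $q=2^m$, and let $\gamma\in\mathbb{F}_q$ be such that the polynomial $X^2+\gamma X+1$ is irreducible over $\mathbb{F}_q$. Let $E=\{(x,y)\in\mathbb{F}_q\times\mathbb{F}_q\mid x^2+\gamma xy+y^2=1\}$ be the canonical ellipse, whose nucleus is the origin $N=(0,0)$. Then $E\cup\{N\}$ is a complete Sidon set in the additive group $\mathbb{F}_q\times\mathbb{F}_q$: $E\cup\{N\}$ is a Sidon set, and for every point $P\in(\mathbb{F}_q\times\mathbb{F}_q)\setminus(E\cup\{N\})$, the set $E\cup\{N\}\cup\{P\}$ is not a Sidon set. -/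
/-- Three of the four elements `x, y, z, w` are pairwise different. -/
def ThreeDistinct {A : Type*} (x y z w : A) : Prop :=
  (x ≠ y ∧ x ≠ z ∧ y ≠ z) ∨ (x ≠ y ∧ x ≠ w ∧ y ≠ w) ∨
    (x ≠ z ∧ x ≠ w ∧ z ≠ w) ∨ (y ≠ z ∧ y ≠ w ∧ z ≠ w)

/-- `S` is a Sidon set in the abelian group `A`: for any `x, y, z, w ∈ S`
of which at least three are pairwise different, `x + y ≠ z + w`. -/
def IsSidon {A : Type*} [AddCommGroup A] (S : Set A) : Prop :=
  ∀ x ∈ S, ∀ y ∈ S, ∀ z ∈ S, ∀ w ∈ S, ThreeDistinct x y z w → x + y ≠ z + w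

open scoped Finset

/-- The absolute trace `x + x² + x⁴ + ⋯ + x^(2^(m-1))` of a field of order `2 ^ m`. -/
def absTrace {F : Type*} [Field F] (m : ℕ) (x : F) : F := ∑ i ∈ Finset.range m, x ^ 2 ^ i

/-- The quadratic form `X² + γXY + Y²`. -/
def ellipseForm {F : Type*} [Field F] (γ : F) (p : F × F) : F :=
  p.1 ^ 2 + γ * p.1 * p.2 + p.2 ^ 2

section AbsTrace

variable {F : Type*} [Field F] {m : ℕ}

lemma absTrace_zero : absTrace m (0 : F) = 0 := by
  simp [absTrace]

lemma absTrace_sq [Fintype F] (hF : Fintype.card F = 2 ^ m) (x : F) :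
    absTrace m (x ^ 2) = absTrace m x := by
  have hq : x ^ 2 ^ m = x := hF ▸ FiniteField.pow_card x
  have h1 := Finset.sum_range_succ (fun i => x ^ 2 ^ i) m
  have h2 := Finset.sum_range_succ' (fun i => x ^ 2 ^ i) m
  simp only [absTrace, ← pow_mul, ← pow_succ']
  rw [h1, hq, pow_zero, pow_one] at h2
  exact (add_right_cancel h2).symm

open Polynomial in
lemma card_absTrace_eq_zero_le [Fintype F] [DecidableEq F] (hm : m ≠ 0) :
    #{x : F | absTrace m x = 0} ≤ 2 ^ (m - 1) := by
  obtain ⟨k, rfl⟩ := Nat.exists_eq_succ_of_ne_zero hm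
  set p : F[X] := ∑ i ∈ Finset.range k, X ^ 2 ^ i with hp
  have hdeg : p.degree < (2 ^ k : ℕ) := by
    refine (degree_sum_le _ _).trans_lt ((Finset.sup_lt_iff (WithBot.bot_lt_coe _)).2 fun i hi => ?_)
    rw [degree_X_pow]
    exact_mod_cast Nat.pow_lt_pow_right one_lt_two (Finset.mem_range.1 hi)
  have hmonic : (X ^ 2 ^ k + p).Monic := monic_X_pow_add hdeg
  have hnat : (X ^ 2 ^ k + p).natDegree = 2 ^ k := natDegree_eq_of_degree_eq_some (by
    rw [degree_add_eq_left_of_degree_lt (by rwa [degree_X_pow]), degree_X_pow])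
  refine (card_le_degree_of_subset_roots (p := X ^ 2 ^ k + p) fun x hx => ?_).trans hnat.le
  have hx' : absTrace (k + 1) x = 0 := by simpa using hx
  rw [mem_roots hmonic.ne_zero, IsRoot.def, ← hx']
  simp [hp, absTrace, Finset.sum_range_succ, eval_finsetSum, add_comm]

variable [CharP F 2]

lemma absTrace_add (x y : F) : absTrace m (x + y) = absTrace m x + absTrace m y := by
  simp only [absTrace, add_pow_char_pow, Finset.sum_add_distrib]

lemma sq_absTrace (x : F) : absTrace m x ^ 2 = absTrace m (x ^ 2) := by
  simp only [absTrace, CharTwo.sum_sq]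
  exact Finset.sum_congr rfl fun i _ => by ring

variable [Fintype F]

lemma absTrace_eq_zero_or_one (hF : Fintype.card F = 2 ^ m) (x : F) :
    absTrace m x = 0 ∨ absTrace m x = 1 := by
  have h := sq_absTrace (m := m) x
  rw [absTrace_sq hF] at h
  have h' : absTrace m x * (absTrace m x - 1) = 0 := by linear_combination h
  rcases mul_eq_zero.1 h' with h | h
  · exact Or.inl h
  · exact Or.inr (sub_eq_zero.1 h)

lemma le_card_absTrace_eq_one [DecidableEq F] (hm : m ≠ 0) (hF : Fintype.card F = 2 ^ m) :
    2 ^ (m - 1) ≤ #{x : F | absTrace m x = 1} := by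
  have h := card_absTrace_eq_zero_le (F := F) hm
  have hunion : #{x : F | absTrace m x = 0} + #{x : F | absTrace m x = 1} = 2 ^ m := by
    rw [← hF, ← Finset.card_univ, ← Finset.card_union_of_disjoint]
    · congr 1
      ext x
      simpa using absTrace_eq_zero_or_one hF x
    · rw [Finset.disjoint_filter]
      intro x _ h0 h1
      exact zero_ne_one (h0.symm.trans h1)
  have : 2 ^ m = 2 * 2 ^ (m - 1) := by rw [← pow_succ', Nat.sub_add_cancel (by omega)]
  omega

lemma exists_sq_add_self_of_absTrace_eq_zero (hm : m ≠ 0) (hF : Fintype.card F = 2 ^ m) {x : F}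
    (hx : absTrace m x = 0) : ∃ a : F, a ^ 2 + a = x := by
  classical
  let f : F →+ F := AddMonoidHom.mk' (fun a => a ^ 2 + a) fun a b => by
    simp only [add_pow_char]; ring
  have hker : Nat.card f.ker ≤ 2 := by
    have hsub : (f.ker : Set F) ⊆ (({0, 1} : Finset F) : Set F) := by
      intro a ha
      have h : a * (a - 1) = 0 := by
        have : a ^ 2 + a = 0 := ha
        rw [CharTwo.sub_eq_add]; linear_combination this
      rcases mul_eq_zero.1 h with h | h
      · simp [h]
      · simp [sub_eq_zero.1 h]
    calc Nat.card f.ker = (f.ker : Set F).ncard := rfl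
      _ ≤ (({0, 1} : Finset F) : Set F).ncard := Set.ncard_le_ncard hsub (Finset.finite_toSet _)
      _ ≤ 2 := by rw [Set.ncard_coe_finset]; exact Finset.card_le_two
  have hcard : Nat.card f.range * Nat.card f.ker = 2 ^ m := by
    rw [← hF, ← Nat.card_eq_fintype_card, ← AddSubgroup.index_ker, AddSubgroup.index_mul_card]
  have hpow : 2 ^ m = 2 ^ (m - 1) * 2 := by rw [← pow_succ, Nat.sub_add_cancel (by omega)]
  have hrange : 2 ^ (m - 1) ≤ #(Finset.univ.image f) := by
    have : Nat.card f.range = #(Finset.univ.image f) := by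
      rw [← Set.ncard_coe_finset, Finset.coe_image, Finset.coe_univ, Set.image_univ]
      rfl
    rw [← this]
    nlinarith
  have hsub : Finset.univ.image f ⊆ ({x : F | absTrace m x = 0} : Finset F) := by
    intro y hy
    obtain ⟨a, -, rfl⟩ := Finset.mem_image.1 hy
    simp [f, absTrace_add, absTrace_sq hF, CharTwo.add_self_eq_zero]
  have heq := Finset.eq_of_subset_of_card_le hsub ((card_absTrace_eq_zero_le hm).trans hrange)
  have hmem : x ∈ Finset.univ.image f := heq ▸ by simpa using hx
  obtain ⟨a, -, ha⟩ := Finset.mem_image.1 hmem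
  exact ⟨a, ha⟩

open Polynomial in
/-- Inversion does not map the hyperplane of elements of trace one into an affine hyperplane. -/
lemma exists_absTrace_eq_one_absTrace_div_ne (hm : 3 ≤ m) (hF : Fintype.card F = 2 ^ m) {b : F}
    (hb : b ≠ 0) (e : F) : ∃ w : F, absTrace m w = 1 ∧ absTrace m (b / w) ≠ e := by
  classical
  by_contra! h
  obtain ⟨k, rfl⟩ : ∃ k, m = k + 1 := ⟨m - 1, by omega⟩
  have hle : ∀ i ∈ Finset.range (k + 1), 2 ^ i ≤ 2 ^ k := fun i hi =>
    Nat.pow_le_pow_right two_pos (Nat.lt_succ_iff.1 (Finset.mem_range.1 hi))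
  set p : F[X] := ∑ i ∈ Finset.range (k + 1), C (b ^ 2 ^ i) * X ^ (2 ^ k - 2 ^ i) +
    C e * (1 + ∑ i ∈ Finset.range k, X ^ 2 ^ i) with hp
  have hdeg : p.degree < (2 ^ k : ℕ) := by
    refine (degree_add_le _ _).trans_lt (max_lt ?_ ?_)
    · refine (degree_sum_le _ _).trans_lt
        ((Finset.sup_lt_iff (WithBot.bot_lt_coe _)).2 fun i hi => ?_)
      refine (degree_C_mul_X_pow_le _ _).trans_lt ?_
      exact_mod_cast Nat.sub_lt (by positivity) (by positivity)
    · rw [← smul_eq_C_mul]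
      refine (degree_smul_le _ _).trans_lt ((degree_add_le _ _).trans_lt (max_lt ?_ ?_))
      · refine degree_one_le.trans_lt ?_
        exact_mod_cast Nat.two_pow_pos k
      · refine (degree_sum_le _ _).trans_lt
          ((Finset.sup_lt_iff (WithBot.bot_lt_coe _)).2 fun i hi => ?_)
        rw [degree_X_pow]
        exact_mod_cast Nat.pow_lt_pow_right one_lt_two (Finset.mem_range.1 hi)
  have hzero : p = 0 := by
    refine eq_zero_of_degree_lt_of_eval_finset_eq_zero {x : F | absTrace (k + 1) x = 1}
      (hdeg.trans_le ?_) fun w hw => ?_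
    · exact_mod_cast le_card_absTrace_eq_one (m := k + 1) (by omega) hF
    · have hw1 : absTrace (k + 1) w = 1 := by simpa using hw
      have hw0 : w ≠ 0 := by
        rintro rfl
        exact zero_ne_one (absTrace_zero.symm.trans hw1)
      have hinv : ∑ i ∈ Finset.range (k + 1), b ^ 2 ^ i * w ^ (2 ^ k - 2 ^ i) = e * w ^ 2 ^ k := by
        rw [← h w hw1, absTrace, Finset.sum_mul]
        refine Finset.sum_congr rfl fun i hi => ?_
        rw [pow_sub₀ _ hw0 (hle i hi), div_pow]
        field_simp
      have hT : ∑ i ∈ Finset.range k, w ^ 2 ^ i = 1 - w ^ 2 ^ k := by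
        rw [← hw1, absTrace, Finset.sum_range_succ, add_sub_cancel_right]
      simp only [hp, eval_add, eval_finsetSum, eval_mul, eval_C, eval_pow, eval_X, eval_one, hinv,
        hT]
      linear_combination e * CharTwo.two_eq_zero (R := F)
  have hpow : ∀ i, 2 ^ i ≠ 2 ^ k - 1 := by
    obtain ⟨j, rfl⟩ : ∃ j, k = j + 2 := ⟨k - 2, by omega⟩
    rintro (_ | i) <;> rw [pow_succ 2 (j + 1), pow_succ 2 j]
    · have := Nat.one_le_two_pow (n := j)
      omega
    · rw [pow_succ]
      have := Nat.one_le_two_pow (n := j)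
      omega
  have hcoeff : p.coeff (2 ^ k - 1) = b := by
    have h1 : ∀ i ∈ Finset.range (k + 1), i ≠ 0 →
        (if 2 ^ k - 1 = 2 ^ k - 2 ^ i then b ^ 2 ^ i else 0) = 0 := by
      intro i hi h0
      have := hle i hi
      have := Nat.one_lt_two_pow h0
      rw [if_neg (by omega)]
    have h2 : ∀ i ∈ Finset.range k, (if 2 ^ k - 1 = 2 ^ i then (1 : F) else 0) = 0 :=
      fun i _ => if_neg (hpow i).symm
    have h3 : 2 ^ k - 1 ≠ 0 := by
      have := Nat.one_lt_two_pow (n := k) (by omega)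
      omega
    simp only [hp, coeff_add, finsetSum_coeff, coeff_C_mul, coeff_X_pow, coeff_one, if_neg h3,
      mul_ite, mul_one, mul_zero]
    rw [Finset.sum_congr rfl h2, Finset.sum_eq_single_of_mem 0 (by simp) h1]
    simp
  exact hb (by rw [← hcoeff, hzero, coeff_zero])

/-- In the hyperplane of elements of trace one, some `u` has `1 / (c² + 1 + c / u)` of trace
one. -/
lemma exists_absTrace_eq_one_absTrace_inv_eq_one (hm : 3 ≤ m) (hF : Fintype.card F = 2 ^ m) {c : F}
    (hc0 : c ≠ 0) (hc1 : c ≠ 1) :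
    ∃ u : F, absTrace m u = 1 ∧ absTrace m ((c ^ 2 + 1 + c / u)⁻¹) = 1 := by
  have h2 : (2 : F) = 0 := CharTwo.two_eq_zero
  have hd : c + 1 ≠ 0 := fun h => hc1 (by linear_combination h - h2)
  have hshift : absTrace m (((c + 1) ^ 2)⁻¹ * c) = 0 := by
    have : ((c + 1) ^ 2)⁻¹ * c = ((c + 1)⁻¹) ^ 2 + (c + 1)⁻¹ := by
      field_simp
      linear_combination -h2
    rw [this, absTrace_add, absTrace_sq hF, CharTwo.add_self_eq_zero]
  obtain ⟨v, hv, hne⟩ := exists_absTrace_eq_one_absTrace_div_ne hm hF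
    (b := (((c + 1) ^ 2)⁻¹) ^ 2 * c) (by simp [hd, hc0]) (absTrace m ((c + 1) ^ 2)⁻¹)
  have hv0 : v ≠ 0 := by
    rintro rfl
    exact zero_ne_one (absTrace_zero.symm.trans hv)
  set u : F := v + ((c + 1) ^ 2)⁻¹ * c with hu
  have hu1 : absTrace m u = 1 := by rw [hu, absTrace_add, hv, hshift, add_zero]
  have hu0 : u ≠ 0 := by
    intro h0
    rw [h0, absTrace_zero] at hu1
    exact zero_ne_one hu1
  refine ⟨u, hu1, ?_⟩
  have hden : (c ^ 2 + 1 + c / u) * u = (c + 1) ^ 2 * v := by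
    have : (c ^ 2 + 1 + c / u) * u = (c ^ 2 + 1) * u + c := by field_simp
    rw [this, hu]
    have : ((c + 1) ^ 2) * (((c + 1) ^ 2)⁻¹ * c) = c := by field_simp
    linear_combination this + h2 * (c - c * v - c * ((c + 1) ^ 2)⁻¹ * c)
  have hsplit : (c ^ 2 + 1 + c / u)⁻¹ =
      ((c + 1) ^ 2)⁻¹ + (((c + 1) ^ 2)⁻¹) ^ 2 * c / v := by
    rw [inv_eq_of_mul_eq_one_right (b := u / ((c + 1) ^ 2 * v))]
    · rw [hu]
      field_simp
    · rw [← mul_div_assoc, hden, div_self (by simp [hd, hv0])]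
  rw [hsplit, absTrace_add]
  rcases absTrace_eq_zero_or_one hF ((c + 1) ^ 2)⁻¹ with h | h <;>
    rcases absTrace_eq_zero_or_one hF ((((c + 1) ^ 2)⁻¹) ^ 2 * c / v) with h' | h' <;>
    simp_all

end AbsTrace

section EllipseForm

variable {F : Type*} [Field F] {γ : F}

lemma ne_zero_of_forall_sq_add_mul_add_one_ne_zero [CharP F 2]
    (hirr : ∀ t : F, t ^ 2 + γ * t + 1 ≠ 0) : γ ≠ 0 := by
  rintro rfl
  exact hirr 1 (by linear_combination CharTwo.two_eq_zero (R := F))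

lemma eq_zero_of_ellipseForm_eq_zero (hirr : ∀ t : F, t ^ 2 + γ * t + 1 ≠ 0) {p : F × F}
    (hp : ellipseForm γ p = 0) : p = 0 := by
  obtain ⟨x, y⟩ := p
  simp only [ellipseForm] at hp
  have hy : y = 0 := by
    by_contra hy
    refine hirr (x / y) ?_
    field_simp
    linear_combination hp
  subst hy
  simpa using hp

variable [CharP F 2]

/-- In the presence of a primitive cube root of unity, no two points of the ellipse sum to a third
one. -/
lemma ellipse_add_add_ne_zero (hirr : ∀ t : F, t ^ 2 + γ * t + 1 ≠ 0) {ω : F}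
    (hω : ω ^ 2 + ω + 1 = 0) {p q r : F × F} (hp : ellipseForm γ p = 1) (hq : ellipseForm γ q = 1)
    (hr : ellipseForm γ r = 1) : p + q + r ≠ 0 := by
  intro h
  have h2 : (2 : F) = 0 := CharTwo.two_eq_zero
  obtain ⟨p1, p2⟩ := p
  obtain ⟨q1, q2⟩ := q
  obtain ⟨r1, r2⟩ := r
  simp only [ellipseForm, Prod.mk_add_mk, Prod.mk_eq_zero] at hp hq hr h
  obtain ⟨ha, hb⟩ := h
  have hr1 : r1 = -(p1 + q1) := by linear_combination ha
  have hr2 : r2 = -(p2 + q2) := by linear_combination hb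
  subst hr1 hr2
  have hB : γ * (p1 * q2 + p2 * q1) = 1 := by grind
  have hz : ellipseForm γ (ω * p1 + q1, ω * p2 + q2) = 0 := by
    simp only [ellipseForm]
    grind
  have hz' := eq_zero_of_ellipseForm_eq_zero hirr hz
  rw [Prod.mk_eq_zero] at hz'
  obtain ⟨h1, h3⟩ := hz'
  have hq1 : q1 = -(ω * p1) := by linear_combination h1
  have hq2 : q2 = -(ω * p2) := by linear_combination h3
  subst hq1 hq2
  grind

/-- Four distinct points of the ellipse do not sum to zero. -/
lemma ellipse_add_add_add_ne_zero (hirr : ∀ t : F, t ^ 2 + γ * t + 1 ≠ 0)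
    {p q r s : F × F} (hp : ellipseForm γ p = 1) (hq : ellipseForm γ q = 1)
    (hr : ellipseForm γ r = 1) (hs : ellipseForm γ s = 1) (hpq : p ≠ q) (hpr : p ≠ r)
    (hqr : q ≠ r) : p + q + r + s ≠ 0 := by
  intro h
  have h2 : (2 : F) = 0 := CharTwo.two_eq_zero
  have hγ := ne_zero_of_forall_sq_add_mul_add_one_ne_zero hirr
  have hbne : ellipseForm γ (q + r) ≠ 0 := fun h0 =>
    hqr (by rw [← CharTwo.add_eq_zero]; exact eq_zero_of_ellipseForm_eq_zero hirr h0)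
  obtain ⟨r1, r2⟩ := r
  obtain ⟨a1, a2, rfl⟩ : ∃ a1 a2, p = (r1 + a1, r2 + a2) := ⟨p.1 - r1, p.2 - r2, by simp⟩
  obtain ⟨b1, b2, rfl⟩ : ∃ b1 b2, q = (r1 + b1, r2 + b2) := ⟨q.1 - r1, q.2 - r2, by simp⟩
  obtain ⟨s1, s2⟩ := s
  simp only [ellipseForm, Prod.mk_add_mk, Prod.mk_eq_zero] at hp hq hr hs h hbne
  obtain ⟨ha, hb⟩ := h
  have hs1 : s1 = r1 + a1 + b1 := by linear_combination ha - h2 * (2 * r1 + a1 + b1)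
  have hs2 : s2 = r2 + a2 + b2 := by linear_combination hb - h2 * (2 * r2 + a2 + b2)
  subst hs1 hs2
  set c := b1 ^ 2 + γ * b1 * b2 + b2 ^ 2 with hc
  have hc0 : c ≠ 0 := by
    intro h0
    apply hbne
    grind
  have hdet : a1 * b2 + a2 * b1 = 0 := by
    refine (mul_eq_zero.1 (?_ : γ * _ = 0)).resolve_left hγ
    grind
  have hBa : γ * (r1 * a2 + r2 * a1) = a1 ^ 2 + γ * a1 * a2 + a2 ^ 2 := by grind
  have hBb : γ * (r1 * b2 + r2 * b1) = c := by grind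
  have h11 : a1 * (a1 + b1) = 0 := (mul_eq_zero.1 (by grind : c * _ = 0)).resolve_left hc0
  have h12 : a1 * (a2 + b2) = 0 := (mul_eq_zero.1 (by grind : c * _ = 0)).resolve_left hc0
  have h21 : a2 * (a1 + b1) = 0 := (mul_eq_zero.1 (by grind : c * _ = 0)).resolve_left hc0
  have h22 : a2 * (a2 + b2) = 0 := (mul_eq_zero.1 (by grind : c * _ = 0)).resolve_left hc0
  by_cases ha0 : a1 = 0 ∧ a2 = 0
  · simp [ha0] at hpr
  · have : a1 + b1 = 0 ∧ a2 + b2 = 0 := by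
      rcases not_and_or.1 ha0 with h | h
      · exact ⟨(mul_eq_zero.1 h11).resolve_left h, (mul_eq_zero.1 h12).resolve_left h⟩
      · exact ⟨(mul_eq_zero.1 h21).resolve_left h, (mul_eq_zero.1 h22).resolve_left h⟩
    rw [CharTwo.add_eq_zero, CharTwo.add_eq_zero] at this
    simp [this] at hpq

variable [Fintype F] {m : ℕ}

lemma absTrace_inv_sq_eq_one (hm : m ≠ 0) (hF : Fintype.card F = 2 ^ m)
    (hirr : ∀ t : F, t ^ 2 + γ * t + 1 ≠ 0) : absTrace m (γ⁻¹ ^ 2) = 1 := by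
  refine (absTrace_eq_zero_or_one hF _).resolve_left fun h => ?_
  obtain ⟨a, ha⟩ := exists_sq_add_self_of_absTrace_eq_zero hm hF h
  have hγ := ne_zero_of_forall_sq_add_mul_add_one_ne_zero hirr
  refine hirr (γ * a) ?_
  have : γ * γ⁻¹ = 1 := mul_inv_cancel₀ hγ
  linear_combination γ ^ 2 * ha + (γ * γ⁻¹ + 1) * this + CharTwo.two_eq_zero (R := F)

/-- A point of the ellipse whose polar product with `p` is `τ * ellipseForm γ p`. -/
lemma exists_ellipseForm_eq_one (hm : m ≠ 0) (hF : Fintype.card F = 2 ^ m)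
    (hirr : ∀ t : F, t ^ 2 + γ * t + 1 ≠ 0) {p : F × F} {τ : F}
    (h : absTrace m (τ ^ 2 * ellipseForm γ p)⁻¹ = 1) :
    ∃ z : F × F, ellipseForm γ z = 1 ∧
      ellipseForm γ (p + z) = ellipseForm γ p + 1 + τ * ellipseForm γ p := by
  have h2 : (2 : F) = 0 := CharTwo.two_eq_zero
  have hγ := ne_zero_of_forall_sq_add_mul_add_one_ne_zero hirr
  have hne : τ ^ 2 * ellipseForm γ p ≠ 0 := by
    intro h0
    rw [h0, inv_zero, absTrace_zero] at h
    exact zero_ne_one h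
  obtain ⟨a, ha⟩ := exists_sq_add_self_of_absTrace_eq_zero hm hF
    (x := (τ ^ 2 * ellipseForm γ p)⁻¹ + γ⁻¹ ^ 2) (by
      rw [absTrace_add, h, absTrace_inv_sq_eq_one hm hF hirr, CharTwo.add_self_eq_zero])
  have hinv := mul_inv_cancel₀ hne
  have hγinv := mul_inv_cancel₀ hγ
  set d := γ⁻¹
  set e := (τ ^ 2 * ellipseForm γ p)⁻¹
  obtain ⟨x, y⟩ := p
  simp only [ellipseForm] at hinv ⊢
  have hz : (τ * (a * x + d * y)) ^ 2 + γ * (τ * (a * x + d * y)) * (τ * (a * y + d * (x + γ * y)))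
      + (τ * (a * y + d * (x + γ * y))) ^ 2 = 1 := by
    grind
  refine ⟨(τ * (a * x + d * y), τ * (a * y + d * (x + γ * y))), hz, ?_⟩
  simp only [Prod.mk_add_mk]
  grind

lemma exists_add_eq_of_absTrace_inv_eq_one (hm : m ≠ 0) (hF : Fintype.card F = 2 ^ m)
    (hirr : ∀ t : F, t ^ 2 + γ * t + 1 ≠ 0) {p : F × F}
    (h : absTrace m (ellipseForm γ p)⁻¹ = 1) :
    ∃ x y : F × F, ellipseForm γ x = 1 ∧ ellipseForm γ y = 1 ∧ x + y = p := by
  obtain ⟨x, hx, hpx⟩ := exists_ellipseForm_eq_one hm hF hirr (p := p) (τ := 1) (by simpa using h)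
  refine ⟨x, p + x, hx, ?_, ?_⟩
  · linear_combination hpx + ellipseForm γ p * CharTwo.two_eq_zero (R := F)
  · rw [add_left_comm, Prod.ext_iff]
    simp [CharTwo.add_self_eq_zero]

/-- Every point off the ellipse other than the nucleus is the sum of three points of the ellipse. -/
lemma exists_ellipse_add_eq_add (hm : 3 ≤ m) (hF : Fintype.card F = 2 ^ m)
    (hirr : ∀ t : F, t ^ 2 + γ * t + 1 ≠ 0) {p : F × F} (hp0 : p ≠ 0) (hp1 : ellipseForm γ p ≠ 1) :
    ∃ x y z : F × F, ellipseForm γ x = 1 ∧ ellipseForm γ y = 1 ∧ ellipseForm γ z = 1 ∧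
      x + y = p + z := by
  obtain ⟨c, hc⟩ := FiniteField.isSquare_of_char_two (ringChar.eq F 2) (ellipseForm γ p)
  have hc0 : c ≠ 0 := by
    rintro rfl
    exact hp0 (eq_zero_of_ellipseForm_eq_zero hirr (by simpa using hc))
  have hc1 : c ≠ 1 := by
    rintro rfl
    exact hp1 (by simpa using hc)
  obtain ⟨u, hu1, hu⟩ := exists_absTrace_eq_one_absTrace_inv_eq_one hm hF hc0 hc1
  have hu0 : u ≠ 0 := by
    rintro rfl
    exact zero_ne_one (absTrace_zero.symm.trans hu1)
  obtain ⟨z, hz, hpz⟩ := exists_ellipseForm_eq_one (by omega) hF hirr (p := p) (τ := (c * u)⁻¹) (by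
    have : (((c * u)⁻¹) ^ 2 * ellipseForm γ p)⁻¹ = u ^ 2 := by
      rw [hc]
      field_simp
    rw [this, absTrace_sq hF, hu1])
  have hform : ellipseForm γ (p + z) = c ^ 2 + 1 + c / u := by
    rw [hpz, hc]
    field_simp
  obtain ⟨x, y, hx, hy, hxy⟩ := exists_add_eq_of_absTrace_inv_eq_one (by omega) hF hirr
    (p := p + z) (by rw [hform, hu])
  exact ⟨x, y, z, hx, hy, hz, hxy⟩

end EllipseForm

lemma exists_sq_add_self_add_one_eq_zero {F : Type*} [Field F] [Fintype F]
    (h3 : 3 ∣ Fintype.card F - 1) : ∃ ω : F, ω ^ 2 + ω + 1 = 0 := by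
  classical
  have : Fact (Nat.Prime 3) := ⟨Nat.prime_three⟩
  obtain ⟨g, hg⟩ := exists_prime_orderOf_dvd_card (G := Fˣ) 3 (by rwa [Fintype.card_units])
  have hg3 : (g : F) ^ 3 = 1 := by
    rw [← Units.val_pow_eq_pow_val, ← hg, pow_orderOf_eq_one, Units.val_one]
  have hg1 : (g : F) - 1 ≠ 0 := by
    intro h
    have : g = 1 := Units.ext (sub_eq_zero.1 h)
    simp [this] at hg
  refine ⟨g, (mul_eq_zero.1 (?_ : ((g : F) - 1) * _ = 0)).resolve_left hg1⟩
  linear_combination hg3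

lemma ThreeDistinct.pairwise_ne {A : Type*} [AddCommGroup A] (h2 : ∀ a : A, a + a = 0)
    {x y z w : A} (h : ThreeDistinct x y z w) (hsum : x + y = z + w) :
    x ≠ y ∧ x ≠ z ∧ x ≠ w ∧ y ≠ z ∧ y ≠ w ∧ z ≠ w := by
  have hself : ∀ a b : A, a + b = 0 → a = b := fun a b hab =>
    add_right_cancel (hab.trans (h2 b).symm)
  have key1 : x = y → z = w := fun e => hself z w (by rw [← hsum, e, h2])
  have key2 : z = w → x = y := fun e => hself x y (by rw [hsum, e, h2])
  have key3 : x = z → y = w := fun e => by subst e; exact add_left_cancel hsum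
  have key4 : y = w → x = z := fun e => by subst e; exact add_right_cancel hsum
  have key5 : x = w → y = z := fun e => by
    subst e; rw [add_comm z] at hsum; exact add_left_cancel hsum
  have key6 : y = z → x = w := fun e => by
    subst e; rw [add_comm] at hsum; exact add_left_cancel hsum
  unfold ThreeDistinct at h
  tauto

/-- For even `m ≥ 4`, `q = 2^m`, and `γ ∈ 𝔽_q` with `X² + γX + 1` irreducible over `𝔽_q`,
the ellipse `X² + γXY + Y² = 1` together with its nucleus `N = (0,0)` is a complete Sidon
set in `𝔽_q × 𝔽_q`. -/
theorem ellipse_with_nucleus_complete_sidon (m : ℕ) (hm : 4 ≤ m) (hmeven : Even m)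
    (F : Type*) [Field F] [Fintype F] (hF : Fintype.card F = 2 ^ m)
    (γ : F)
    (hirr : Irreducible (Polynomial.X ^ 2 + Polynomial.C γ * Polynomial.X + 1 : Polynomial F))
    (E : Set (F × F)) (hE : E = {p : F × F | p.1 ^ 2 + γ * p.1 * p.2 + p.2 ^ 2 = 1})
    (N : F × F) (hN : N = (0, 0)) :
    IsSidon (E ∪ {N}) ∧ ∀ P : F × F, P ∉ E ∪ {N} → ¬ IsSidon (E ∪ {N} ∪ {P}) := by
  have h2 : (2 : F) = 0 := by
    have := FiniteField.cast_card_eq_zero F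
    rw [hF, Nat.cast_pow] at this
    exact_mod_cast pow_eq_zero_iff (by omega) |>.1 this
  have : CharP F 2 := CharTwo.of_one_ne_zero_of_two_eq_zero one_ne_zero h2
  have hself : ∀ a : F × F, a + a = 0 := fun a => by
    ext <;> simp [CharTwo.add_self_eq_zero]
  have hroot : ∀ t : F, t ^ 2 + γ * t + 1 ≠ 0 := fun t ht => by
    refine hirr.not_isRoot_of_natDegree_ne_one ?_ (x := t) (by simpa using ht)
    have : (Polynomial.X ^ 2 + Polynomial.C γ * Polynomial.X + 1 : Polynomial F).natDegree = 2 := by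
      compute_degree!
    omega
  have hmemE : ∀ p, p ∈ E ↔ ellipseForm γ p = 1 := fun p => by rw [hE]; rfl
  obtain rfl : N = 0 := hN
  refine ⟨?_, fun p hp hS => ?_⟩
  · obtain ⟨ω, hω⟩ := exists_sq_add_self_add_one_eq_zero (F := F) (by
      obtain ⟨k, rfl⟩ := hmeven
      rw [hF, ← two_mul, pow_mul]
      simpa using Nat.sub_dvd_pow_sub_pow 4 1 k)
    intro x hx y hy z hz w hw h hsum
    obtain ⟨hxy, hxz, hxw, hyz, hyw, hzw⟩ := h.pairwise_ne hself hsum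
    have hsum4 : x + y + z + w = 0 := by rw [hsum, add_assoc, hself]
    simp only [Set.mem_union, Set.mem_singleton_iff, hmemE] at hx hy hz hw
    rcases hx with hx | rfl
    · rcases hy with hy | rfl
      · rcases hz with hz | rfl
        · rcases hw with hw | rfl
          · exact ellipse_add_add_add_ne_zero hroot hx hy hz hw hxy hxz hyz hsum4
          · exact ellipse_add_add_ne_zero hroot hω hx hy hz (by simpa using hsum4)
        · exact ellipse_add_add_ne_zero hroot hω hx hy (hw.resolve_right hzw.symm)
            (by simpa using hsum4)
      · exact ellipse_add_add_ne_zero hroot hω hx (hz.resolve_right hyz.symm)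
          (hw.resolve_right hyw.symm) (by simpa using hsum4)
    · exact ellipse_add_add_ne_zero hroot hω (hy.resolve_right hxy.symm)
        (hz.resolve_right hxz.symm) (hw.resolve_right hxw.symm) (by simpa using hsum4)
  · simp only [Set.mem_union, Set.mem_singleton_iff, hmemE, not_or] at hp
    obtain ⟨x, y, z, hx, hy, hz, hsum⟩ := exists_ellipse_add_eq_add (by omega) hF hroot hp.2 hp.1
    have hxp : x ≠ p := by rintro rfl; exact hp.1 hx
    have hyp : y ≠ p := by rintro rfl; exact hp.1 hy
    have hxy : x ≠ y := by
      rintro rfl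
      rw [hself] at hsum
      have : p = z := add_right_cancel (hsum.symm.trans (hself z).symm)
      exact hp.1 (this ▸ hz)
    exact hS x (by simp [hmemE, hx]) y (by simp [hmemE, hy]) p (by simp) z (by simp [hmemE, hz])
      (Or.inl ⟨hxy, hxp, hyp⟩) hsum
end

section
/- Let $q=2^m\geq 16$ be a power of two, let $\gamma\in\mathbb{F}_q$ be such that $X^2+\gamma X+1$ is irreducible over $\mathbb{F}_q$, and let $c\in\mathbb{F}_q$ with $c\neq 0$ and $c\neq\gamma^3$. Then there exist elements $x,y\in\mathbb{F}_q$ with $x\neq y$ such that $(x^2+\gamma x+1)(y^2+\gamma y+1)+c(x+y)=0$. -/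
section ArtinSchreier

variable {F : Type*} [Field F] [CharP F 2]

/-- The Artin-Schreier map `z ↦ z² + z` in characteristic two. -/
def artinSchreierTwo (F : Type*) [Field F] [CharP F 2] : F →+ F where
  toFun z := z ^ 2 + z
  map_zero' := by simp
  map_add' a b := by rw [CharTwo.add_sq]; ring

theorem artinSchreierTwo_apply (z : F) : artinSchreierTwo F z = z ^ 2 + z := rfl

theorem coe_ker_artinSchreierTwo : ((artinSchreierTwo F).ker : Set F) = {0, 1} := by
  ext z
  have h : z ^ 2 + z = z * (z - 1) := by rw [CharTwo.sub_eq_add]; ring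
  simp [AddMonoidHom.mem_ker, artinSchreierTwo_apply, h, sub_eq_zero]

theorem index_range_artinSchreierTwo [Finite F] : (artinSchreierTwo F).range.index = 2 := by
  have hker : Nat.card (artinSchreierTwo F).ker = 2 := by
    rw [← SetLike.coe_sort_coe, coe_ker_artinSchreierTwo, Nat.card_coe_set_eq,
      Set.ncard_pair zero_ne_one]
  have h₁ := (artinSchreierTwo F).ker.card_mul_index
  have h₂ := (artinSchreierTwo F).range.card_mul_index
  rw [AddSubgroup.index_ker, hker, ← h₂, mul_comm] at h₁
  exact (Nat.eq_of_mul_eq_mul_left Nat.card_pos h₁).symm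

/-- The values of the reciprocal of a quadratic polynomial without roots are not all contained in
a subgroup of index two, since each of these nonzero values is taken at most twice. -/
theorem exists_div_quadratic_notMem_of_index_two {F : Type*} [Field F] [Finite F]
    {H : AddSubgroup F} (hH : H.index = 2) {a b e : F} (hb : b ≠ 0)
    (hne : ∀ x, x ^ 2 + a * x + e ≠ 0) : ∃ x, b / (x ^ 2 + a * x + e) ∉ H := by
  classical
  have := Fintype.ofFinite F
  by_contra! h
  set T : Finset F := (H : Set F).toFinset.erase 0
  have hfiber : ∀ u ∈ T, (Finset.univ.filter fun x => b / (x ^ 2 + a * x + e) = u).card ≤ 2 := by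
    intro u _
    by_cases hu : ∃ x₀, b / (x₀ ^ 2 + a * x₀ + e) = u
    · obtain ⟨x₀, rfl⟩ := hu
      refine (Finset.card_le_card (t := {x₀, -a - x₀}) fun x hx => ?_).trans Finset.card_le_two
      have hx := (Finset.mem_filter.mp hx).2
      rw [div_eq_div_iff (hne x) (hne x₀)] at hx
      have hx := mul_left_cancel₀ hb hx
      have hprod : (x - x₀) * (x - (-a - x₀)) = 0 := by linear_combination -hx
      simpa [sub_eq_zero] using mul_eq_zero.mp hprod
    · push Not at hu
      simp [hu]
  have hle := Finset.card_le_mul_card_image_of_maps_to (s := Finset.univ) (t := T)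
    (fun x _ => by simpa [T, hb, hne x] using h x) 2 hfiber
  have hcard := H.card_mul_index
  have hT : T.card + 1 = Nat.card H := by
    rw [Finset.card_erase_add_one (by simp [H.zero_mem]), Set.toFinset_card,
      Nat.card_eq_fintype_card]
    rfl
  rw [hH, Nat.card_eq_fintype_card (α := F)] at hcard
  rw [Finset.card_univ] at hle
  omega

end ArtinSchreier

/-- With `c = γ (s² + 1)`, the quartic has a point: solving the equation for `y` at a given `x` is
an Artin-Schreier problem, whose right-hand side reduces to a constant plus the reciprocal of
a quadratic polynomial in `x`. -/
theorem exists_quartic_zero {F : Type*} [Field F] [Finite F] [CharP F 2] {γ s : F}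
    (hirr : ∀ x : F, x ^ 2 + γ * x + 1 ≠ 0) (hs : s ≠ 1) (hsγ : 1 + s ≠ γ) :
    ∃ x y : F, (x ^ 2 + γ * x + 1) * (y ^ 2 + γ * y + 1) + γ * (s ^ 2 + 1) * (x + y) = 0 := by
  have h2 : (2 : F) = 0 := CharTwo.two_eq_zero
  have hγ : γ ≠ 0 := fun h => hirr 1 (by linear_combination h + h2)
  by_cases hM : ∃ x : F, x ^ 2 + γ * x + s ^ 2 = 0
  · obtain ⟨x, hx⟩ := hM
    refine ⟨x, x + s + 1, ?_⟩
    linear_combination ((x + s + 1) ^ 2 + γ * (x + s + 1) + 1 + (s ^ 2 + 1)) * hx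
      + ((s ^ 2 + 1) * (x * s + x + s + 1 + γ * (x + s + 1))
        - s ^ 2 * ((x + s + 1) ^ 2 + γ * (x + s + 1) + 1)) * h2
  push Not at hM
  have hs1 : 1 + s ≠ 0 := fun h => hs (by linear_combination h - h2)
  have hA : (s ^ 2 + 1) * (γ + (s ^ 2 + 1) + γ * s) / γ ^ 2 ≠ 0 := by
    have h : (s ^ 2 + 1) * (γ + (s ^ 2 + 1) + γ * s) = (1 + s) ^ 3 * (1 + s - γ) := by
      grind
    rw [h]
    exact div_ne_zero (mul_ne_zero (pow_ne_zero _ hs1) (sub_ne_zero.mpr hsγ)) (pow_ne_zero _ hγ)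
  have hindex := index_range_artinSchreierTwo (F := F)
  obtain ⟨x, hx⟩ := exists_div_quadratic_notMem_of_index_two hindex hA hM
  have hMx := hM x
  have hNx := hirr x
  set H := (artinSchreierTwo F).range
  set f := (x ^ 2 + γ * x + 1) * (x ^ 2 + γ * x + 1 + γ * (s ^ 2 + 1) * x) /
    (γ * (x ^ 2 + γ * x + s ^ 2)) ^ 2 with hf
  have hconst : (γ ^ 2)⁻¹ ∉ H := by
    rintro ⟨z, hz⟩
    rw [artinSchreierTwo_apply] at hz
    refine hirr (γ * z) ?_
    field_simp at hz
    linear_combination hz + h2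
  have hsum : f + (γ ^ 2)⁻¹ + (s ^ 2 + 1) * (γ + (s ^ 2 + 1) + γ * s) / γ ^ 2 /
      (x ^ 2 + γ * x + s ^ 2) ∈ H := by
    refine ⟨(s ^ 2 + 1) * (1 + x + s) / (γ * (x ^ 2 + γ * x + s ^ 2)), ?_⟩
    rw [artinSchreierTwo_apply, hf]
    generalize hM_eq : x ^ 2 + γ * x + s ^ 2 = M at hMx ⊢
    field_simp
    grind
  have hfH : f ∈ H := by
    rw [AddSubgroup.add_mem_iff_of_index_two hindex,
      AddSubgroup.add_mem_iff_of_index_two hindex] at hsum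
    tauto
  obtain ⟨z, hz⟩ := hfH
  rw [artinSchreierTwo_apply, hf] at hz
  refine ⟨x, γ * (x ^ 2 + γ * x + s ^ 2) / (x ^ 2 + γ * x + 1) * z, ?_⟩
  generalize hN_eq : x ^ 2 + γ * x + 1 = N at hNx hz ⊢
  generalize hM_eq : x ^ 2 + γ * x + s ^ 2 = M at hMx hz ⊢
  field_simp at hz ⊢
  linear_combination hz + z * γ ^ 2 * M * (hM_eq - hN_eq)
    + (z * γ ^ 2 * M + N ^ 2 + γ * (s ^ 2 + 1) * x * N) * h2

/-- For `q = 2^m ≥ 16`, `γ ∈ 𝔽_q` with `X² + γX + 1` irreducible over `𝔽_q`, and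
`c ∈ 𝔽_q \ {0, γ³}`, the quartic equation `(x² + γx + 1)(y² + γy + 1) + c(x + y) = 0`
has a solution with `x ≠ y`. -/
theorem ellipse_quartic_solution (m : ℕ)
    (F : Type*) [Field F] [Fintype F] (hF : Fintype.card F = 2 ^ m)
    (hq : 16 ≤ Fintype.card F) (γ : F)
    (hirr : Irreducible (Polynomial.X ^ 2 + Polynomial.C γ * Polynomial.X + 1 : Polynomial F))
    (c : F) (hc0 : c ≠ 0) (hcγ : c ≠ γ ^ 3) :
    ∃ x y : F, x ≠ y ∧
      (x ^ 2 + γ * x + 1) * (y ^ 2 + γ * y + 1) + c * (x + y) = 0 := by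
  have : CharP F 2 := charP_of_card_eq_prime_pow hF
  have hroot : ∀ x : F, x ^ 2 + γ * x + 1 ≠ 0 := by
    intro x hx
    refine hirr.not_isRoot_of_natDegree_ne_one (x := x) ?_ (by simpa using hx)
    have : (Polynomial.X ^ 2 + Polynomial.C γ * Polynomial.X + 1 : Polynomial F).natDegree = 2 := by
      compute_degree!
    omega
  have hγ : γ ≠ 0 := fun h => hroot 1 (by
    linear_combination h + (CharTwo.two_eq_zero : (2 : F) = 0))
  obtain ⟨s, hs⟩ := FiniteField.isSquare_of_char_two (ringChar.eq F 2) (c / γ + 1)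
  have hc : c = γ * (s ^ 2 + 1) := by
    rw [div_add_one hγ, div_eq_iff hγ] at hs
    linear_combination hs - γ * (CharTwo.two_eq_zero : (2 : F) = 0)
  obtain ⟨x, y, hxy⟩ := exists_quartic_zero (s := s) hroot
    (fun h => hc0 (by rw [hc, h]; grind [CharTwo.two_eq_zero (R := F)]))
    (fun h => hcγ (by rw [hc, ← h]; grind [CharTwo.two_eq_zero (R := F)]))
  rw [← hc] at hxy
  refine ⟨x, y, fun h => ?_, hxy⟩
  rw [h, CharTwo.add_self_eq_zero, mul_zero, add_zero] at hxy
  exact mul_ne_zero (hroot y) (hroot y) hxy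
end
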